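/- arXiv:math/0310421 — 2 statements merged into one kernel-verified Lean document; each statement's English description precedes it below -/
import Mathlib

section
/- Let H be a complex Hilbert space and let B be a maximal abelian self-adjoint subalgebra of B(H), i.e. a star-subalgebra of B(H) equal to its own commutant. Then B is locally cyclic: for every finite-dimensional subspace L of H there exists a vector ξ ∈ H such that L is contained in the norm closure of {bξ : b ∈ B}. -/
/-- The cyclic subspace: closure of `Bξ`. -/
noncomputable def cycSub {H : Type*} [NormedAddCommGroup H] [InnerProductSpace ℂ H]
    [CompleteSpace H] (B : StarSubalgebra ℂ (H →L[ℂ] H)) (ξ : H) : Submodule ℂ H :=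
  ((Subalgebra.toSubmodule B.toSubalgebra).map
    (ContinuousLinearMap.apply ℂ H ξ).toLinearMap).topologicalClosure

section
variable {H : Type*} [NormedAddCommGroup H] [InnerProductSpace ℂ H]
    [CompleteSpace H] (B : StarSubalgebra ℂ (H →L[ℂ] H))

theorem cycSub_coe (ξ : H) :
    (cycSub B ξ : Set H) = closure {v : H | ∃ b ∈ B, v = b ξ} := by
  unfold cycSub
  rw [Submodule.topologicalClosure_coe]
  congr 1
  ext v
  constructor
  · rintro ⟨b, hb, rfl⟩
    exact ⟨b, hb, rfl⟩
  · rintro ⟨b, hb, rfl⟩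
    exact ⟨b, hb, rfl⟩

theorem cycSub_closed (ξ : H) : IsClosed (cycSub B ξ : Set H) := by
  rw [cycSub_coe]; exact isClosed_closure

theorem cycSub_apply_self (ξ : H) {b : H →L[ℂ] H} (hb : b ∈ B) : b ξ ∈ cycSub B ξ := by
  rw [← SetLike.mem_coe, cycSub_coe]
  exact subset_closure ⟨b, hb, rfl⟩

theorem cycSub_self (ξ : H) : ξ ∈ cycSub B ξ := by
  simpa using cycSub_apply_self B ξ (one_mem B)

theorem cycSub_inv (ξ : H) {b : H →L[ℂ] H} (hb : b ∈ B) {v : H} (hv : v ∈ cycSub B ξ) :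
    b v ∈ cycSub B ξ := by
  rw [← SetLike.mem_coe, cycSub_coe] at hv ⊢
  refine map_mem_closure b.continuous hv ?_
  rintro _ ⟨c, hc, rfl⟩
  exact ⟨b * c, mul_mem hb hc, rfl⟩

theorem cycSub_mono {ξ ζ : H} (h : ξ ∈ cycSub B ζ) : cycSub B ξ ≤ cycSub B ζ := by
  rw [← SetLike.coe_subset_coe, cycSub_coe B ξ]
  refine closure_minimal ?_ (cycSub_closed B ζ)
  rintro _ ⟨c, hc, rfl⟩
  exact cycSub_inv B ζ hc h

theorem cycSub_pair
    (hmax : (B : Set (H →L[ℂ] H)) = {x : H →L[ℂ] H | ∀ b ∈ B, x * b = b * x}) (ξ η : H) :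
    ∃ ζ, ξ ∈ cycSub B ζ ∧ η ∈ cycSub B ζ := by
  have hcomp : CompleteSpace (cycSub B ξ) :=
    (cycSub_closed B ξ).isComplete.completeSpace_coe
  set p : H →L[ℂ] H := (cycSub B ξ).starProjection with hp
  have hpB : p ∈ B := by
    rw [← SetLike.mem_coe, hmax]
    intro b hb
    ext x
    change p (b x) = b (p x)
    refine Submodule.eq_starProjection_of_mem_of_inner_eq_zero
      (cycSub_inv B ξ hb (Submodule.starProjection_apply_mem _ x)) ?_
    intro w hw
    rw [← map_sub, ← ContinuousLinearMap.adjoint_inner_right]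
    exact Submodule.starProjection_inner_eq_zero x _ (cycSub_inv B ξ (star_mem hb) hw)
  have hpξ : p ξ = ξ := Submodule.starProjection_eq_self_iff.2 (cycSub_self B ξ)
  have hpp : ∀ x, p (p x) = p x := fun x =>
    Submodule.starProjection_eq_self_iff.2 (Submodule.starProjection_apply_mem _ x)
  have h1 : ξ ∈ cycSub B (ξ + (η - p η)) := by
    have := cycSub_apply_self B (ξ + (η - p η)) hpB
    simpa [hpξ, hpp] using this
  refine ⟨ξ + (η - p η), h1, ?_⟩
  have h2 : p η ∈ cycSub B (ξ + (η - p η)) :=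
    cycSub_mono B h1 (Submodule.starProjection_apply_mem _ η)
  have h3 := sub_mem (cycSub_self B (ξ + (η - p η))) h1
  have h4 := add_mem h3 h2
  simpa using h4

end

/-- A maximal abelian self-adjoint subalgebra of `B(H)` (i.e. a star-subalgebra equal to
its own commutant) is locally cyclic: every finite-dimensional subspace `L` of `H` is
contained in the closure of `Bξ` for some vector `ξ`. -/
theorem masa_locally_cyclic
    {H : Type*} [NormedAddCommGroup H] [InnerProductSpace ℂ H] [CompleteSpace H]
    (B : StarSubalgebra ℂ (H →L[ℂ] H))
    (hmax : (B : Set (H →L[ℂ] H)) = {x : H →L[ℂ] H | ∀ b ∈ B, x * b = b * x})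
    (L : Submodule ℂ H) (hL : FiniteDimensional ℂ L) :
    ∃ ξ : H, (L : Set H) ⊆ closure {v : H | ∃ b ∈ B, v = b ξ} := by
  suffices h : ∃ ξ : H, L ≤ cycSub B ξ by
    obtain ⟨ξ, h⟩ := h
    refine ⟨ξ, ?_⟩
    rw [← cycSub_coe]
    exact h
  have hfg : L.FG := Module.Finite.iff_fg.1 hL
  refine Submodule.fg_induction (motive := fun N _ => ∃ ξ : H, N ≤ cycSub B ξ) ?_ ?_ L hfg
  · intro x
    exact ⟨x, (Submodule.span_singleton_le_iff_mem _ _).2 (cycSub_self B x)⟩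
  · rintro N₁ N₂ _ _ ⟨ξ, h1⟩ ⟨η, h2⟩
    obtain ⟨ζ, hξ, hη⟩ := cycSub_pair B hmax ξ η
    exact ⟨ζ, sup_le (h1.trans (cycSub_mono B hξ)) (h2.trans (cycSub_mono B hη))⟩
end

section
/- Let E be a nonempty set and u : E × E → ℂ a bounded function. Then u is positive definite if and only if there exist an index set I and functions φ_i : E → ℂ (i ∈ I) with sup_{x∈E} Σ_{i∈I} |φ_i(x)|² < ∞ such that for all x, y ∈ E the family (φ_i(x)·conj(φ_i(y)))_{i∈I} is absolutely summable and u(x, y) = Σ_{i∈I} φ_i(x)·conj(φ_i(y)). -/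
open ComplexConjugate
open scoped ComplexOrder

/-- A function `u : E × E → ℂ` is positive definite if for all `x_1, …, x_n ∈ E` and
`c_1, …, c_n ∈ ℂ`, the sum `Σ_{k,l} c_k conj(c_l) u(x_k, x_l)` is a nonnegative real. -/
def IsPosDefKernel {E : Type*} (u : E → E → ℂ) : Prop :=
  ∀ (n : ℕ) (x : Fin n → E) (c : Fin n → ℂ),
    0 ≤ ∑ k : Fin n, ∑ l : Fin n, c k * conj (c l) * u (x k) (x l)

theorem IsPosDefKernel.conj_symm {E : Type*} {u : E → E → ℂ} (h : IsPosDefKernel u) (x y : E) :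
    conj (u x y) = u y x := by
  have hx := h 1 ![x] ![1]
  have hy := h 1 ![y] ![1]
  have h1 := h 2 ![x, y] ![1, 1]
  have h2 := h 2 ![x, y] ![1, Complex.I]
  simp [Fin.sum_univ_two, Complex.le_def] at hx hy h1 h2
  apply Complex.ext
  · simp; linarith [h2.2]
  · simp; linarith [h1.2]

theorem IsPosDefKernel.finsupp {E : Type*} {u : E → E → ℂ} (h : IsPosDefKernel u) (f : E →₀ ℂ) :
    0 ≤ f.sum fun x w ↦ f.sum fun x' w' ↦ conj w * w' * u x x' := by
  have e := f.support.equivFin.symm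
  have := h _ (fun k => (e k : E)) (fun k => conj (f (e k)))
  rw [e.sum_comp (fun a => ∑ l, conj (f a) * conj (conj (f (e l))) * u a (e l))] at this
  have h2 : ∀ a : f.support, ∑ l, conj (f a) * conj (conj (f (e l))) * u a (e l)
      = ∑ b : f.support, conj (f a) * (f b) * u a b := fun a => by
    rw [e.sum_comp (fun b => conj (f a) * conj (conj (f b)) * u a b)]
    simp
  simp only [h2] at this
  rw [Finset.sum_coe_sort f.support (fun a => ∑ b : f.support, conj (f a) * (f b) * u a b)] at this
  simp only [fun a => Finset.sum_coe_sort f.support (fun b => conj (f a) * (f b) * u a b)] at this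
  exact this

theorem IsPosDefKernel.exists_hilbert {E : Type u} {u : E → E → ℂ} (h : IsPosDefKernel u) :
    ∃ (I : Type u) (φ : I → E → ℂ), ∀ x y, HasSum (fun i => φ i x * conj (φ i y)) (u x y) := by
  let K : Matrix E E (ℂ →L[ℂ] ℂ) := fun x y => u x y • ContinuousLinearMap.id ℂ ℂ
  have hKa : ∀ x y z, K x y z = u x y * z := fun x y z => by
    change (u x y • ContinuousLinearMap.id ℂ ℂ) z = _
    simp
  have hK : K.PosSemidef := by
    have T := (RKHS.posSemidef_tfae (K := K)).out 0 2
    refine T.mpr ⟨?_, fun f => ?_⟩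
    · refine Matrix.IsHermitian.ext fun x y => ?_
      change star (u y x • (1 : ℂ →L[ℂ] ℂ)) = u x y • (1 : ℂ →L[ℂ] ℂ)
      rw [star_smul, star_one, ← h.conj_symm y x]
      rfl
    · have := (Complex.le_def.mp (h.finsupp f)).1
      have e : ∀ x w x' w', inner ℂ (K x' x w) w' = conj w * w' * u x x' := fun x w x' w' => by
        rw [hKa, ← h.conj_symm x' x]
        simp
        ring
      simp only [e]
      exact this
  have : Fact K.PosSemidef := ⟨hK⟩
  obtain ⟨w, b, hb⟩ := exists_hilbertBasis ℂ (RKHS.OfKernel K)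
  refine ⟨w, fun i x => inner ℂ (RKHS.kerFun (RKHS.OfKernel K) x 1) (b i), fun x y => ?_⟩
  have := b.hasSum_inner_mul_inner (RKHS.kerFun (RKHS.OfKernel K) x 1)
    (RKHS.kerFun (RKHS.OfKernel K) y 1)
  rw [← RKHS.kernel_inner, RKHS.OfKernel.kernel_ofKernel] at this
  simp only [inner_conj_symm]
  have e : inner ℂ (K y x 1) 1 = u x y := by
    rw [hKa, ← h.conj_symm y x]
    simp
  rw [e] at this
  exact this

/-- A bounded function `u : E × E → ℂ` is positive definite iff
`u(x,y) = Σ_{i∈I} φ_i(x) conj(φ_i(y))` for a family of functions `φ_i : E → ℂ` with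
`sup_x Σ_i |φ_i(x)|² < ∞`. -/
theorem isPosDefKernel_iff_exists_sq_summable_family
    {E : Type u} [Nonempty E] (u : E → E → ℂ) (hu : ∃ C : ℝ, ∀ x y, ‖u x y‖ ≤ C) :
    IsPosDefKernel u ↔
      ∃ (I : Type u) (φ : I → E → ℂ),
        (∃ C : ℝ, ∀ x : E, ∃ S : ℝ, HasSum (fun i => ‖φ i x‖ ^ 2) S ∧ S ≤ C) ∧
        (∀ x y : E, Summable (fun i => ‖φ i x * conj (φ i y)‖) ∧
          HasSum (fun i => φ i x * conj (φ i y)) (u x y)) := by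
  constructor
  · intro h
    obtain ⟨C, hC⟩ := hu
    obtain ⟨I, φ, hφ⟩ := h.exists_hilbert
    refine ⟨I, φ, ⟨C, fun x => ⟨(u x x).re, ?_, ?_⟩⟩, fun x y => ⟨(hφ x y).summable.norm, hφ x y⟩⟩
    · have := Complex.hasSum_re (hφ x x)
      convert this using 2 with i
      rw [Complex.mul_conj, Complex.ofReal_re, Complex.normSq_eq_norm_sq]
    · exact (Complex.re_le_norm _).trans (hC x x)
  · rintro ⟨I, φ, -, hφ⟩ n x c
    have := hasSum_sum (s := Finset.univ) fun k _ => hasSum_sum (s := Finset.univ) fun l _ =>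
      ((hφ (x k) (x l)).2.mul_left (c k * conj (c l)))
    refine this.nonneg fun i => ?_
    have e : ∑ k, ∑ l, c k * conj (c l) * (φ i (x k) * conj (φ i (x l))) =
        (∑ k, c k * φ i (x k)) * conj (∑ k, c k * φ i (x k)) := by
      rw [map_sum, Finset.sum_mul_sum]
      refine Finset.sum_congr rfl fun k _ => Finset.sum_congr rfl fun l _ => ?_
      rw [map_mul]; ring
    simp only [e]
    rw [Complex.mul_conj]
    exact_mod_cast Complex.normSq_nonneg _
end
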